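/- Let p be a prime and G a finite group whose Sylow p-subgroups are cyclic. Let F be a field of characteristic p and M a finite-dimensional indecomposable FG-module. Then for every integer j ≥ 0, dim H^j(G,M) ≤ 1. -/

import Mathlib

universe u

open CategoryTheory

namespace ChainComplex

variable {C : Type*} [Category C] [Preadditive C]

/-- A morphism out of the `j`-th term of a chain complex is a coboundary if it factors through the
differential leaving that term. -/
def IsCoboundary (K : ChainComplex C ℕ) {j : ℕ} {A : C} (c : K.X j ⟶ A) : Prop :=
  ∃ b : K.X ((ComplexShape.down ℕ).next j) ⟶ A, K.d j _ ≫ b = c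

namespace IsCoboundary

variable {K L : ChainComplex C ℕ} {j : ℕ} {A B : C}

lemma of_d_comp {i : ℕ} (b : K.X i ⟶ A) : IsCoboundary K (K.d j i ≫ b) := by
  by_cases h : (ComplexShape.down ℕ).Rel j i
  · obtain rfl := (ComplexShape.down ℕ).next_eq' h
    exact ⟨b, rfl⟩
  · exact ⟨0, by rw [K.shape _ _ h]; simp⟩

lemma comp {c : K.X j ⟶ A} (hc : IsCoboundary K c) (f : A ⟶ B) : IsCoboundary K (c ≫ f) := by
  obtain ⟨b, rfl⟩ := hc
  exact ⟨b ≫ f, by simp⟩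

lemma add {c c' : K.X j ⟶ A} (hc : IsCoboundary K c) (hc' : IsCoboundary K c') :
    IsCoboundary K (c + c') := by
  obtain ⟨b, rfl⟩ := hc
  obtain ⟨b', rfl⟩ := hc'
  exact ⟨b + b', by simp⟩

lemma of_homotopyEquiv (e : HomotopyEquiv K L) {c : L.X j ⟶ A} (hd : ∀ i, L.d i j ≫ c = 0)
    (hc : IsCoboundary K (e.hom.f j ≫ c)) : IsCoboundary L c := by
  obtain ⟨b, hb⟩ := hc
  have h := e.homotopyInvHomId.comm j
  refine ⟨e.inv.f _ ≫ b - e.homotopyInvHomId.hom _ _ ≫ c, ?_⟩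
  have h2 := congr($h ≫ c)
  simp only [dNext, prevD, AddMonoidHom.mk'_apply, Preadditive.add_comp, Category.assoc, hd,
    Limits.comp_zero, add_zero, HomologicalComplex.comp_f, HomologicalComplex.id_f,
    Category.id_comp] at h2
  rw [← hb] at h2
  rw [Preadditive.comp_sub, sub_eq_iff_eq_add, add_comm c, ← h2]
  simp

end IsCoboundary

end ChainComplex

namespace Rep

section relTrace

variable {k G : Type u} [CommRing k] [Group G] (P : Subgroup G) {X Y Z : Rep.{u} k G}

/-- The conjugate of a morphism of representations of a subgroup by a coset. -/
def conjBy (f : res P.subtype X ⟶ res P.subtype Y) : G ⧸ P → (X →ₗ[k] Y) :=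
  Quotient.lift (fun g : G => Y.ρ g ∘ₗ f.hom.toLinearMap ∘ₗ X.ρ g⁻¹) <| by
    intro a b hab
    obtain ⟨p, rfl⟩ : ∃ p : P, b = a * p := ⟨⟨a⁻¹ * b, QuotientGroup.leftRel_apply.1 hab⟩, by simp⟩
    ext x
    have := hom_comm_apply f p (X.ρ (a * p)⁻¹ x)
    simp only [res_obj_ρ, MonoidHom.coe_comp, Function.comp_apply, Subgroup.coe_subtype] at this
    simp only [LinearMap.comp_apply, map_mul Y.ρ, Module.End.mul_apply,
      Representation.IntertwiningMap.toLinearMap_apply]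
    rw [← this, ← Module.End.mul_apply, ← map_mul]
    simp

lemma conjBy_mk (f : res P.subtype X ⟶ res P.subtype Y) (g : G) (x : X) :
    conjBy P f (g : G ⧸ P) x = Y.ρ g (f.hom (X.ρ g⁻¹ x)) := rfl

variable [Fintype (G ⧸ P)]

/-- The relative trace of a morphism between restrictions of representations to a subgroup. -/
noncomputable def relTrace (f : res P.subtype X ⟶ res P.subtype Y) : X ⟶ Y :=
  ofHom (LinearMap.intertwiningMap_of_isIntertwiningMap _ _ (∑ q : G ⧸ P, conjBy P f q) (by
    intro g x
    simp only [LinearMap.sum_apply, map_sum]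
    refine (Fintype.sum_equiv (MulAction.toPerm g) _ _ fun q => ?_).symm
    induction q using QuotientGroup.induction_on with | H a =>
    simp only [MulAction.toPerm_apply, MulAction.Quotient.smul_coe, conjBy_mk, smul_eq_mul]
    rw [map_mul Y.ρ, Module.End.mul_apply, ← Module.End.mul_apply (X.ρ (g * a)⁻¹), ← map_mul X.ρ]
    simp))

lemma relTrace_apply (f : res P.subtype X ⟶ res P.subtype Y) (x : X) :
    (relTrace P f).hom x = ∑ q : G ⧸ P, conjBy P f q x :=
  LinearMap.sum_apply _ _ _

lemma comp_relTrace (a : X ⟶ Y) (f : res P.subtype Y ⟶ res P.subtype Z) :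
    a ≫ relTrace P f = relTrace P (resMap P.subtype a ≫ f) := by
  ext x
  change (relTrace P f).hom (a.hom x) = (relTrace P _).hom x
  rw [relTrace_apply, relTrace_apply]
  refine Finset.sum_congr rfl fun q _ => ?_
  induction q using QuotientGroup.induction_on with | H g =>
  rw [conjBy_mk, conjBy_mk, ← hom_comm_apply]
  rfl

lemma relTrace_resMap (a : X ⟶ Y) :
    relTrace P (resMap P.subtype a) = (P.index : k) • a := by
  ext x
  change (relTrace P (resMap P.subtype a)).hom x = (P.index : k) • a.hom x
  have h (q : G ⧸ P) : conjBy P (resMap P.subtype a) q x = a.hom x := by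
    induction q using QuotientGroup.induction_on with | H g =>
    rw [conjBy_mk]
    change Y.ρ g (a.hom (X.ρ g⁻¹ x)) = _
    rw [← hom_comm_apply, ← Module.End.mul_apply, ← map_mul]
    simp
  simp [relTrace_apply, h, Subgroup.index_eq_card, Nat.cast_smul_eq_nsmul]

lemma relTrace_sub (f g : res P.subtype X ⟶ res P.subtype Y) :
    relTrace P (f - g) = relTrace P f - relTrace P g := by
  ext x
  change (relTrace P (f - g)).hom x = (relTrace P f).hom x - (relTrace P g).hom x
  rw [relTrace_apply, relTrace_apply, relTrace_apply, ← Finset.sum_sub_distrib]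
  refine Finset.sum_congr rfl fun q _ => ?_
  induction q using QuotientGroup.induction_on with | H a =>
  rw [conjBy_mk, conjBy_mk, conjBy_mk, ← map_sub]
  rfl

end relTrace

end Rep

namespace Module.End

variable {F V : Type*} [Field F] [AddCommGroup V] [Module F V]

/-- For a dual vector `l` and a vector `m`, the endomorphism
`w ↦ ∑ i ≤ h, l (x ^ i w) • x ^ (h - i) m`. -/
noncomputable def sandwich (x : Module.End F V) (h : ℕ) (l : Module.Dual F V) (m : V) :
    Module.End F V :=
  ∑ i ∈ Finset.range (h + 1), (l ∘ₗ (x ^ i)).smulRight ((x ^ (h - i)) m)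

lemma sandwich_apply (x : Module.End F V) (h : ℕ) (l : Module.Dual F V) (m w : V) :
    sandwich x h l m w = ∑ i ∈ Finset.range (h + 1), l ((x ^ i) w) • (x ^ (h - i)) m := by
  simp [sandwich, LinearMap.sum_apply]

lemma sandwich_commute (x : Module.End F V) (h : ℕ) (l : Module.Dual F V) (m : V)
    (hl : ∀ w, l ((x ^ (h + 1)) w) = 0) (hm : (x ^ (h + 1)) m = 0) (w : V) :
    sandwich x h l m (x w) = x (sandwich x h l m w) := by
  simp only [sandwich_apply, map_sum, map_smul]
  rw [Finset.sum_range_succ, Finset.sum_range_succ']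
  have h1 : l ((x ^ h) (x w)) = 0 := by rw [← hl w, pow_succ]; rfl
  have h2 : x ((x ^ (h - 0)) m) = 0 := by rw [← hm, pow_succ']; rfl
  rw [h1, h2, zero_smul, smul_zero]
  congr 1
  refine Finset.sum_congr rfl fun i hi => ?_
  have h3 : h - i = h - (i + 1) + 1 := by have := Finset.mem_range.1 hi; omega
  rw [h3, pow_succ x i, pow_succ' x (h - (i + 1))]
  rfl

lemma sandwich_apply_of_apply_eq_zero (x : Module.End F V) (h : ℕ) (l : Module.Dual F V)
    (m w : V) (hw : x w = 0) : sandwich x h l m w = l w • (x ^ h) m := by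
  rw [sandwich_apply, Finset.sum_eq_single 0]
  · simp
  · rintro (_ | i) _ hi
    · exact absurd rfl hi
    · simp [pow_succ, hw]
  · simp

lemma sandwich_apply_sub_mem_range (x : Module.End F V) (h : ℕ) (l : Module.Dual F V)
    (m w : V) : sandwich x h l m w - l ((x ^ h) w) • m ∈ LinearMap.range x := by
  rw [sandwich_apply, Finset.sum_range_succ]
  simp only [tsub_self, pow_zero, one_apply, add_sub_cancel_right]
  refine Submodule.sum_mem _ fun i hi => Submodule.smul_mem _ _ ?_
  have h3 : h - i = h - (i + 1) + 1 := by have := Finset.mem_range.1 hi; omega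
  rw [h3, pow_succ']
  exact ⟨_, rfl⟩

/-- `u` can be separated from `v` modulo `B` by an endomorphism commuting with `x`. -/
def Separates (x : Module.End F V) (B : Submodule F V) (u v : V) : Prop :=
  ∃ f : Module.End F V, (∀ w, f (x w) = x (f w)) ∧ f u - u ∈ B ∧ ∃ c : F, f (v + c • u) ∈ B

lemma separates_of_mem_ker (x : Module.End F V) (h : ℕ) {u v : V} (hu : x u = 0) (hv : x v = 0)
    (h1 : u ∈ LinearMap.range (x ^ h)) (h2 : u ∉ LinearMap.range (x ^ (h + 1))) :
    Separates x ⊥ u v := by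
  obtain ⟨m, rfl⟩ := h1
  obtain ⟨l, hl1, hl2⟩ := Submodule.exists_dual_map_eq_bot_of_notMem h2 inferInstance
  have hl (w : V) : l ((x ^ (h + 1)) w) = 0 := by
    rw [← Submodule.mem_bot F, ← hl2]
    exact ⟨_, ⟨w, rfl⟩, rfl⟩
  have hm : (x ^ (h + 1)) m = 0 := by rw [pow_succ']; exact hu
  set a := l ((x ^ h) m) with ha
  refine ⟨sandwich x h (a⁻¹ • l) m, sandwich_commute x h _ m (by simp [hl]) hm, ?_,
    -(a⁻¹ * l v), ?_⟩
  · rw [sandwich_apply_of_apply_eq_zero _ _ _ _ _ hu]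
    simp [← ha, hl1]
  · rw [sandwich_apply_of_apply_eq_zero _ _ _ _ _ (by simp [hu, hv])]
    simp only [map_add, map_smul, LinearMap.smul_apply, ← ha, smul_eq_mul, inv_mul_cancel₀ hl1,
      mul_one, add_neg_cancel, zero_smul, Submodule.zero_mem]

lemma separates_of_mem_ker_sup_range (x : Module.End F V) (h : ℕ) {u : V} (v : V)
    (hu : u ∈ LinearMap.ker (x ^ (h + 1)) ⊔ LinearMap.range x)
    (hu' : u ∉ LinearMap.ker (x ^ h) ⊔ LinearMap.range x) :
    Separates x (LinearMap.range x) u v := by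
  obtain ⟨m, hm, _, ⟨z, rfl⟩, rfl⟩ := Submodule.mem_sup.1 hu
  have h2 : (x ^ h) m ∉ LinearMap.range (x ^ (h + 1)) := by
    rintro ⟨y, hy⟩
    refine hu' (Submodule.mem_sup.2 ⟨m - x y, ?_, x (y + z), ⟨_, rfl⟩, ?_⟩)
    · rw [LinearMap.mem_ker, map_sub, ← hy, pow_succ]
      simp
    · rw [map_add]
      abel
  obtain ⟨l, hl1, hl2⟩ := Submodule.exists_dual_map_eq_bot_of_notMem h2 inferInstance
  have hl (w : V) : l ((x ^ (h + 1)) w) = 0 := by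
    rw [← Submodule.mem_bot F, ← hl2]
    exact ⟨_, ⟨w, rfl⟩, rfl⟩
  have hl' (w : V) : l ((x ^ h) (x w)) = 0 := by rw [← hl w, pow_succ]; rfl
  set a := l ((x ^ h) m) with ha
  refine ⟨sandwich x h (a⁻¹ • l) m, sandwich_commute x h _ m (by simp [hl]) hm, ?_,
    -(a⁻¹ * l ((x ^ h) v)), ?_⟩
  · have := sandwich_apply_sub_mem_range x h (a⁻¹ • l) m (m + x z)
    simp only [map_add, LinearMap.smul_apply, hl', add_zero, ← ha, smul_eq_mul,
      mul_zero, inv_mul_cancel₀ hl1, one_smul] at this ⊢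
    rw [← sub_sub]
    exact Submodule.sub_mem _ this ⟨z, rfl⟩
  · have := sandwich_apply_sub_mem_range x h (a⁻¹ • l) m
      (v + (-(a⁻¹ * l ((x ^ h) v))) • (m + x z))
    have h0 : (a⁻¹ • l) ((x ^ h) (v + (-(a⁻¹ * l ((x ^ h) v))) • (m + x z))) = 0 := by
      simp only [map_add, map_smul, LinearMap.smul_apply, hl', ← ha, smul_eq_mul, mul_zero,
        add_zero, inv_mul_cancel₀ hl1, mul_one, add_neg_cancel]
    rwa [h0, zero_smul, sub_zero] at this

lemma separates_bot_of_isNilpotent {x : Module.End F V} (hx : IsNilpotent x) {u v : V}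
    (hu : x u = 0) (hv : x v = 0) (hu0 : u ≠ 0) : Separates x ⊥ u v := by
  classical
  obtain ⟨n, hn⟩ := hx
  have hex : ∃ h, u ∉ LinearMap.range (x ^ h) := ⟨n, by simpa [hn, eq_comm] using hu0⟩
  obtain ⟨h, hh⟩ : ∃ h, Nat.find hex = h + 1 := Nat.exists_eq_succ_of_ne_zero fun h0 => by
    have := Nat.find_spec hex
    rw [h0] at this
    exact this ⟨u, by simp⟩
  exact separates_of_mem_ker x h hu hv (not_not.1 (Nat.find_min hex (m := h) (by omega)))
    (hh ▸ Nat.find_spec hex)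

lemma separates_range_of_isNilpotent {x : Module.End F V} (hx : IsNilpotent x) {u : V} (v : V)
    (hu0 : u ∉ LinearMap.range x) : Separates x (LinearMap.range x) u v := by
  classical
  obtain ⟨n, hn⟩ := hx
  have hex : ∃ h, u ∈ LinearMap.ker (x ^ h) ⊔ LinearMap.range x := ⟨n, by simp [hn]⟩
  obtain ⟨h, hh⟩ : ∃ h, Nat.find hex = h + 1 := Nat.exists_eq_succ_of_ne_zero fun h0 => by
    have := Nat.find_spec hex
    rw [h0, pow_zero, one_eq_id, LinearMap.ker_id, bot_sup_eq] at this
    exact hu0 this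
  exact separates_of_mem_ker_sup_range x h v (hh ▸ Nat.find_spec hex)
    (Nat.find_min hex (m := h) (by omega))

end Module.End

namespace Rep

open ChainComplex

lemma leftRegularHomEquiv_applyAsHom_sub_comp {k C : Type u} [CommRing k] [CommGroup C]
    (A : Rep.{u} k C) (g : C) (c : leftRegular k C ⟶ A) :
    leftRegularHomEquiv A ((applyAsHom (leftRegular k C) g - 𝟙 _) ≫ c) =
      (A.ρ g - 1) (leftRegularHomEquiv A c) := by
  rw [Preadditive.sub_comp, Category.id_comp, applyAsHom_comm, map_sub]
  rfl

lemma isNilpotent_apply_sub_one {F C : Type u} [Field F] [Group C] {p n : ℕ} (hp : p.Prime)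
    [CharP F p] (hC : Nat.card C = p ^ n) (g : C) (A : Rep.{u} F C) : IsNilpotent (A.ρ g - 1) := by
  have := Fact.mk hp
  rcases subsingleton_or_nontrivial A with h | h
  · exact ⟨1, Subsingleton.elim _ _⟩
  have : CharP (Module.End F A) p :=
    charP_of_injective_algebraMap (algebraMap F (Module.End F A)).injective p
  refine ⟨p ^ n, ?_⟩
  rw [sub_pow_char_pow_of_commute _ _ (Commute.one_right _), one_pow, ← map_pow, ← hC,
    pow_card_eq_one', map_one, sub_self]

namespace FiniteCyclicGroup

variable {k C : Type u} [CommRing k] [CommGroup C] [Fintype C] {g : C}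
  {hg : ∀ x, x ∈ Subgroup.zpowers g} {A : Rep.{u} k C} {j : ℕ}

/-- The value at `1` of a cochain on the periodic resolution of a finite cyclic group. -/
noncomputable def evalOne (c : (resolution k g hg).complex.X j ⟶ A) : A :=
  leftRegularHomEquiv (k := k) A c

/-- The cochain on the periodic resolution of a finite cyclic group with a given value at `1`. -/
noncomputable def ofValue (hg : ∀ x, x ∈ Subgroup.zpowers g) (j : ℕ) (z : A) :
    (resolution k g hg).complex.X j ⟶ A :=
  (leftRegularHomEquiv (k := k) A).symm z

lemma evalOne_ofValue (z : A) : evalOne (ofValue hg j z) = z :=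
  (leftRegularHomEquiv A).apply_symm_apply z

lemma evalOne_injective {c d : (resolution k g hg).complex.X j ⟶ A} (h : evalOne c = evalOne d) :
    c = d := (leftRegularHomEquiv A).injective h

lemma evalOne_sub (c d : (resolution k g hg).complex.X j ⟶ A) :
    evalOne (c - d) = evalOne c - evalOne d := map_sub (leftRegularHomEquiv A) _ _

lemma evalOne_add_smul (c d : (resolution k g hg).complex.X j ⟶ A) (r : k) :
    evalOne (c + r • d) = evalOne c + r • evalOne d :=
  ((leftRegularHomEquiv A).map_add _ _).trans
    (congrArg _ ((leftRegularHomEquiv A).map_smul _ _))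

lemma evalOne_comp (c : (resolution k g hg).complex.X j ⟶ A) (f : A ⟶ A) :
    evalOne (c ≫ f) = f.hom (evalOne c) := rfl

lemma evalOne_d_comp (hj : Odd (j + 1)) (c : (resolution k g hg).complex.X j ⟶ A) :
    evalOne ((resolution k g hg).complex.d (j + 1) j ≫ c) = (A.ρ g - 1) (evalOne c) := by
  have h : (resolution k g hg).complex.d (j + 1) j = applyAsHom (leftRegular k C) g - 𝟙 _ :=
    (dif_pos rfl).trans (dif_neg (Nat.not_even_iff_odd.2 hj))
  rw [h]
  exact leftRegularHomEquiv_applyAsHom_sub_comp A g c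

lemma isCoboundary_of_odd (hj : Odd j) {c : (resolution k g hg).complex.X j ⟶ A}
    (hc : evalOne c ∈ LinearMap.range (A.ρ g - 1)) :
    IsCoboundary (resolution k g hg).complex c := by
  obtain ⟨i, rfl⟩ : ∃ i, j = i + 1 := ⟨j - 1, by have := hj.pos; omega⟩
  obtain ⟨z, hz⟩ := hc
  have hb : c = (resolution k g hg).complex.d (i + 1) i ≫ ofValue hg i z :=
    evalOne_injective (by rw [evalOne_d_comp hj, evalOne_ofValue, hz])
  rw [hb]
  exact .of_d_comp _

lemma isCoboundary_of_evalOne_eq_zero {c : (resolution k g hg).complex.X j ⟶ A}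
    (hc : evalOne c = 0) : IsCoboundary (resolution k g hg).complex c :=
  ⟨0, evalOne_injective (by rw [hc, Limits.comp_zero]; exact map_zero (leftRegularHomEquiv A))⟩

lemma apply_evalOne_eq_zero (hj : Even j) {c : (resolution k g hg).complex.X j ⟶ A}
    (hc : (resolution k g hg).complex.d (j + 1) j ≫ c = 0) : (A.ρ g - 1) (evalOne c) = 0 := by
  rw [← evalOne_d_comp hj.add_one, hc]
  exact map_zero (leftRegularHomEquiv A)

end FiniteCyclicGroup

open FiniteCyclicGroup

/-- An endomorphism commuting with the action of a generator is a morphism of representations. -/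
def homOfCommute {k C : Type u} [CommRing k] [Group C] [Finite C] {g : C}
    (hg : ∀ x, x ∈ Subgroup.zpowers g) (A : Rep.{u} k C) (f : Module.End k A)
    (hf : ∀ w, f ((A.ρ g - 1) w) = (A.ρ g - 1) (f w)) : A ⟶ A :=
  ofHom (LinearMap.intertwiningMap_of_isIntertwiningMap _ _ f (by
    have h1 : Commute f (A.ρ g) := LinearMap.ext fun w => by
      have := hf w
      simp only [LinearMap.sub_apply, map_sub, Module.End.one_apply, sub_left_inj] at this
      exact this
    intro x v
    obtain ⟨n, rfl⟩ := mem_powers_iff_mem_zpowers.2 (hg x)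
    simp only [map_pow]
    exact congr($(h1.pow_right n) v)))

lemma exists_separating_hom {F C : Type u} [Field F] [CommGroup C] [Fintype C] {p n : ℕ}
    (hp : p.Prime) [CharP F p] (hC : Nat.card C = p ^ n) {g : C}
    (hg : ∀ x, x ∈ Subgroup.zpowers g) (S : ProjectiveResolution (trivial F C F))
    {A : Rep.{u} F C} {j : ℕ} {c d : S.complex.X j ⟶ A}
    (hc : ∀ i, S.complex.d i j ≫ c = 0) (hd : ∀ i, S.complex.d i j ≫ d = 0)
    (hc' : ¬ IsCoboundary S.complex c) :
    ∃ f : A ⟶ A, IsCoboundary S.complex (c ≫ f - c) ∧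
      ∃ r : F, IsCoboundary S.complex ((d + r • c) ≫ f) := by
  let e := ProjectiveResolution.homotopyEquiv (resolution F g hg) S
  have hx := isNilpotent_apply_sub_one hp hC g A
  obtain ⟨B, ⟨f, hf, h1, r, h2⟩, hB⟩ : ∃ B : Submodule F A,
      Module.End.Separates (A.ρ g - 1) B (evalOne (e.hom.f j ≫ c)) (evalOne (e.hom.f j ≫ d)) ∧
      ∀ b : (resolution F g hg).complex.X j ⟶ A, evalOne b ∈ B → IsCoboundary _ b := by
    rcases Nat.even_or_odd j with hj | hj
    · refine ⟨⊥, Module.End.separates_bot_of_isNilpotent hx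
        (apply_evalOne_eq_zero hj ?_) (apply_evalOne_eq_zero hj ?_)
        fun h0 => hc' (.of_homotopyEquiv e hc (isCoboundary_of_evalOne_eq_zero h0)),
        fun b hb => isCoboundary_of_evalOne_eq_zero hb⟩
      · rw [← e.hom.comm_assoc, hc, Limits.comp_zero]
      · rw [← e.hom.comm_assoc, hd, Limits.comp_zero]
    · exact ⟨LinearMap.range (A.ρ g - 1), Module.End.separates_range_of_isNilpotent hx _
        fun h0 => hc' (.of_homotopyEquiv e hc (isCoboundary_of_odd hj h0)),
        fun b hb => isCoboundary_of_odd hj hb⟩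
  refine ⟨homOfCommute hg A f hf, .of_homotopyEquiv e (fun i => ?_) (hB _ ?_), r,
    .of_homotopyEquiv e (fun i => ?_) (hB _ ?_)⟩
  · rw [Preadditive.comp_sub, ← Category.assoc, hc, Limits.zero_comp, sub_zero]
  · rw [Preadditive.comp_sub, ← Category.assoc, evalOne_sub, evalOne_comp]
    exact h1
  · rw [← Category.assoc, Preadditive.comp_add, Linear.comp_smul, hc, hd]
    simp
  · rw [← Category.assoc, evalOne_comp, Preadditive.comp_add, Linear.comp_smul, evalOne_add_smul]
    exact h2

variable {F G : Type u} [Field F] [Group G]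

lemma end_pow_hom {A : Rep.{u} F G} (f : End A) (n : ℕ) :
    (f ^ n : End A).hom.toLinearMap = f.hom.toLinearMap ^ n := by
  induction n with
  | zero => rfl
  | succ n ih => rw [pow_succ, pow_succ, ← ih]; rfl

/-- Fitting's lemma: an endomorphism of a finite-dimensional indecomposable representation is an
isomorphism or nilpotent. -/
lemma isIso_or_isNilpotent_of_indecomposable {A : Rep.{u} F G} [FiniteDimensional F A]
    (hA : ∀ P Q : Submodule F A, (∀ (g : G) (x : A), x ∈ P → A.ρ g x ∈ P) →
      (∀ (g : G) (x : A), x ∈ Q → A.ρ g x ∈ Q) → IsCompl P Q → P = ⊥ ∨ Q = ⊥)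
    (f : End A) : IsIso (f : A ⟶ A) ∨ ∃ n : ℕ, f ^ n = 0 := by
  obtain ⟨n, hn, hn0⟩ := ((f.hom.toLinearMap.eventually_isCompl_ker_pow_range_pow).and
    (Filter.eventually_gt_atTop 0)).exists
  rw [← end_pow_hom] at hn
  have hcomm (g : G) (x : A) : (f ^ n : End A).hom.toLinearMap (A.ρ g x) =
      A.ρ g ((f ^ n : End A).hom.toLinearMap x) := hom_comm_apply _ g x
  rcases hA _ _ (fun g x hx => by
      rw [LinearMap.mem_ker] at hx ⊢; rw [hcomm, hx, map_zero]) (fun g x hx => by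
      obtain ⟨y, rfl⟩ := hx; exact ⟨A.ρ g y, hcomm g y⟩) hn with h | h
  · left
    rw [end_pow_hom] at h
    have hinj : Function.Injective f.hom.toLinearMap := by
      rw [← LinearMap.ker_eq_bot, eq_bot_iff, ← h]
      obtain ⟨m, rfl⟩ := Nat.exists_eq_succ_of_ne_zero hn0.ne'
      intro x hx
      rw [LinearMap.mem_ker, pow_succ, Module.End.mul_apply, LinearMap.mem_ker.1 hx, map_zero]
    have := (mono_iff_injective f).2 hinj
    have := (epi_iff_surjective f).2 (LinearMap.injective_iff_surjective.1 hinj)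
    exact isIso_of_mono_of_epi _
  · right
    refine ⟨n, ?_⟩
    exact hom_ext (Representation.IntertwiningMap.ext (LinearMap.range_eq_bot.1 h))

section

variable (P : Subgroup G) [Fintype (G ⧸ P)]

lemma isCoboundary_relTrace {K : ChainComplex (Rep.{u} F G) ℕ} {A : Rep.{u} F G} {j : ℕ}
    {f : res P.subtype (K.X j) ⟶ res P.subtype A}
    (hf : IsCoboundary (((resFunctor P.subtype).mapHomologicalComplex _).obj K) f) :
    IsCoboundary K (relTrace P f) := by
  obtain ⟨b, rfl⟩ := hf
  exact ⟨relTrace P b, comp_relTrace P _ _⟩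

end

lemma isCoboundary_comp_pow {K : ChainComplex (Rep.{u} F G) ℕ} {A : Rep.{u} F G} {j : ℕ}
    {c : K.X j ⟶ A} {f : End A} {a : F} (h : IsCoboundary K (c ≫ (f : A ⟶ A) - a • c)) (m : ℕ) :
    IsCoboundary K (c ≫ ((f ^ m : End A) : A ⟶ A) - a ^ m • c) := by
  induction m with
  | zero =>
    have h0 : c ≫ 𝟙 A - a ^ 0 • c = 0 := by simp
    exact ⟨0, by rw [Limits.comp_zero]; exact h0.symm⟩
  | succ m ih =>
    have h1 := (ih.comp f).add (h.comp (a ^ m • 𝟙 A))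
    have h2 : ((f ^ (m + 1) : End A) : A ⟶ A) = ((f ^ m : End A) : A ⟶ A) ≫ f := by
      rw [pow_succ']; rfl
    convert h1 using 1
    rw [h2]
    simp [pow_succ, Preadditive.sub_comp, smul_smul, smul_sub]

theorem exists_isCoboundary_add_smul [Finite G] {p : ℕ} (hp : p.Prime)
    (hSylow : ∀ P : Sylow p G, IsCyclic P) [CharP F p] {A : Rep.{u} F G} [FiniteDimensional F A]
    (hA : ∀ P Q : Submodule F A, (∀ (g : G) (x : A), x ∈ P → A.ρ g x ∈ P) →
      (∀ (g : G) (x : A), x ∈ Q → A.ρ g x ∈ Q) → IsCompl P Q → P = ⊥ ∨ Q = ⊥)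
    (S : ProjectiveResolution (trivial F G F)) {j : ℕ} {c d : S.complex.X j ⟶ A}
    (hc : ∀ i, S.complex.d i j ≫ c = 0) (hd : ∀ i, S.complex.d i j ≫ d = 0)
    (hc' : ¬ IsCoboundary S.complex c) : ∃ r : F, IsCoboundary S.complex (d + r • c) := by
  have := Fact.mk hp
  obtain ⟨P⟩ : Nonempty (Sylow p G) := inferInstance
  have := hSylow P
  have : Fintype (G ⧸ P.toSubgroup) := Fintype.ofFinite _
  have : Fintype P.toSubgroup := Fintype.ofFinite _
  have hidx : ((P.toSubgroup.index : ℕ) : F) ≠ 0 := by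
    rw [Ne, CharP.cast_eq_zero_iff F p]
    exact P.not_dvd_index
  obtain ⟨g, hg⟩ := IsCyclic.exists_generator (α := P.toSubgroup)
  obtain ⟨n, hn⟩ := IsPGroup.iff_card.1 P.isPGroup'
  let : CommGroup P.toSubgroup := IsCyclic.commGroup
  have hres (c : S.complex.X j ⟶ A) (hc : ∀ i, S.complex.d i j ≫ c = 0) (i : ℕ) :
      resMap P.toSubgroup.subtype (S.complex.d i j) ≫ resMap P.toSubgroup.subtype c = 0 := by
    have := (resFunctor P.toSubgroup.subtype).congr_map (hc i)
    rwa [Functor.map_comp, Functor.map_zero] at this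
  have key := exists_separating_hom (F := F) hp hn hg
    ((resFunctor P.toSubgroup.subtype).mapProjectiveResolution S)
    (A := res P.toSubgroup.subtype A) (j := j) (c := resMap P.toSubgroup.subtype c)
    (d := resMap P.toSubgroup.subtype d) (hres c hc) (hres d hd) (fun h => hc' (by
      have := (isCoboundary_relTrace P.toSubgroup h).comp ((P.toSubgroup.index : F)⁻¹ • 𝟙 A)
      simpa [relTrace_resMap, hidx] using this))
  obtain ⟨f, h1, r, h2⟩ := key
  replace h1 : IsCoboundary S.complex
      (c ≫ relTrace P.toSubgroup f - (P.toSubgroup.index : F) • c) := by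
    rw [comp_relTrace, ← relTrace_resMap, ← relTrace_sub]
    exact isCoboundary_relTrace P.toSubgroup h1
  replace h2 : IsCoboundary S.complex ((d + r • c) ≫ relTrace P.toSubgroup f) := by
    rw [comp_relTrace]
    exact isCoboundary_relTrace P.toSubgroup h2
  let ψ : End A := relTrace P.toSubgroup f
  rcases isIso_or_isNilpotent_of_indecomposable hA ψ with h | ⟨m, hm⟩
  · exact ⟨r, by simpa using h2.comp (inv (ψ : A ⟶ A))⟩
  · exfalso
    have := (isCoboundary_comp_pow h1 m).comp (-((P.toSubgroup.index : F) ^ m)⁻¹ • 𝟙 A)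
    rw [hm] at this
    apply hc'
    convert this using 1
    have h0 : c ≫ ((0 : End A) : A ⟶ A) = 0 := Limits.comp_zero
    rw [h0]
    simp [smul_smul, hidx]

lemma finrank_homology_linearYonedaObj_le_one {K : ChainComplex (Rep.{u} F G) ℕ}
    {A : Rep.{u} F G} {j : ℕ}
    (h : ∀ c d : K.X j ⟶ A, (∀ i, K.d i j ≫ c = 0) → (∀ i, K.d i j ≫ d = 0) →
      ¬ IsCoboundary K c → ∃ r : F, IsCoboundary K (d + r • c)) :
    Module.finrank F ((K.linearYonedaObj F A).homology j) ≤ 1 := by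
  let L := K.linearYonedaObj F A
  have hπ : Function.Surjective (L.homologyπ j) :=
    (ModuleCat.epi_iff_surjective _).1 inferInstance
  let ι (z : L.cycles j) : K.X j ⟶ A := L.iCycles j z
  have hι (z : L.cycles j) (i : ℕ) : K.d i j ≫ ι z = 0 :=
    congr(ModuleCat.Hom.hom $(L.iCycles_d j i) z)
  have hcob (z : L.cycles j) (hz : IsCoboundary K (ι z)) : L.homologyπ j z = 0 := by
    obtain ⟨b, hb⟩ := hz
    have h1 : L.toCycles _ j b = z := by
      apply (ModuleCat.mono_iff_injective (L.iCycles j)).1 inferInstance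
      exact congr(ModuleCat.Hom.hom $(L.toCycles_i _ j) b).trans hb
    rw [← h1]
    exact congr(ModuleCat.Hom.hom $(L.toCycles_comp_homologyπ _ j) b)
  by_cases hz : ∃ z : L.cycles j, ¬ IsCoboundary K (ι z)
  · obtain ⟨z, hz⟩ := hz
    refine finrank_le_one (L.homologyπ j z) fun w => ?_
    obtain ⟨y, rfl⟩ := hπ w
    obtain ⟨r, hr⟩ := h (ι z) (ι y) (hι z) (hι y) hz
    have h2 : ι (y + r • z) = ι y + r • ι z := by
      exact ((L.iCycles j).hom.map_add _ _).trans (congrArg _ ((L.iCycles j).hom.map_smul _ _))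
    rw [← h2] at hr
    have h3 := hcob _ hr
    rw [map_add, map_smul] at h3
    exact ⟨-r, by rw [neg_smul, neg_eq_iff_add_eq_zero, add_comm, h3]⟩
  · push Not at hz
    refine finrank_le_one 0 fun w => ⟨0, ?_⟩
    obtain ⟨y, rfl⟩ := hπ w
    rw [smul_zero, hcob y (hz y)]

end Rep

/-- Let `p` be a prime and `G` a finite group with cyclic Sylow `p`-subgroups.  Let `F`
be a field of characteristic `p` and `M` a finite-dimensional indecomposable `FG`-module.
Then `dim Hʲ(G,M) ≤ 1` for every `j ≥ 0`. -/
theorem stmt_19 (p : ℕ) (hp : p.Prime) (G : Type u) [Group G] [Finite G]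
    (hSylow : ∀ P : Sylow p G, IsCyclic P)
    (F : Type u) [Field F] [CharP F p]
    (M : Type u) [AddCommGroup M] [Module F M] [FiniteDimensional F M]
    (ρ : Representation F G M)
    (hnontrivial : Nontrivial M)
    (hindec : ∀ P Q : Submodule F M,
      (∀ (g : G) (x : M), x ∈ P → ρ g x ∈ P) →
      (∀ (g : G) (x : M), x ∈ Q → ρ g x ∈ Q) →
      IsCompl P Q → P = ⊥ ∨ Q = ⊥) :
    ∀ j : ℕ, Module.finrank F (groupCohomology (Rep.of ρ) j) ≤ 1 := by
  intro j
  rw [(groupCohomologyIso (Rep.of ρ) j (Rep.barResolution F G)).toLinearEquiv.finrank_eq]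
  exact Rep.finrank_homology_linearYonedaObj_le_one fun c d hc hd hc' =>
    Rep.exists_isCoboundary_add_smul hp hSylow hindec (Rep.barResolution F G) hc hd hc'
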